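/- Let Ω₂ ⊂ Ω₁ ⊂ ℝⁿ be bounded domains and F : Ω₁ → ℝⁿ, G : Ω₂ → ℝⁿ homeomorphisms onto their images with F = G on a neighborhood of ∂Ω₂ intersected with Ω₂. Then the map F̃ defined by F̃ = F on Ω₁ \ Ω₂ and F̃ = G on Ω₂ is a homeomorphism of Ω₁ onto F(Ω₁). -/

import Mathlib

open Classical

/-- The function `t ↦ det (1 + t (A - 1))` is a polynomial of degree at most `dim E`, so its value
at `1` is an affine combination, independent of `A`, of its values at `dim E + 1` nodes. -/
theorem exists_det_eq_sum_det_one_add_smul {E : Type*} [NormedAddCommGroup E] [NormedSpace ℝ E]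
    [FiniteDimensional ℝ E] (t : ℕ → ℝ) (ht : Function.Injective t) :
    ∃ (s : Finset ℕ) (c : ℕ → ℝ), ∑ i ∈ s, c i = 1 ∧ ∀ A : E →L[ℝ] E,
      A.det = ∑ i ∈ s, c i * (1 + t i • (A - 1)).det := by
  set d := Module.finrank ℝ E
  set s := Finset.range (d + 1)
  set c : ℕ → ℝ := fun i => (Lagrange.basis s t i).eval 1
  have key : ∀ A : E →L[ℝ] E, A.det = ∑ i ∈ s, c i * (1 + t i • (A - 1)).det := by
    intro A
    let b := Module.finBasis ℝ E
    let M : Matrix (Fin d) (Fin d) ℝ := LinearMap.toMatrix b b ((A - 1 : E →L[ℝ] E) : E →ₗ[ℝ] E)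
    let p : Polynomial ℝ := Matrix.det
      ((Polynomial.X : Polynomial ℝ) • M.map Polynomial.C + (1 : Matrix _ _ ℝ).map Polynomial.C)
    have hp : ∀ x, p.eval x = (1 + x • (A - 1)).det := by
      intro x
      have h1 : (1 + x • (A - 1)).det
          = LinearMap.det ((1 + x • (A - 1) : E →L[ℝ] E) : E →ₗ[ℝ] E) := rfl
      rw [h1, ← LinearMap.det_toMatrix b]
      simp only [p, ← Polynomial.coe_evalRingHom, RingHom.map_det]
      congr 1
      ext i j
      simp [M, LinearMap.toMatrix_apply, Matrix.one_apply, Finsupp.single_apply, eq_comm, add_comm]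
      split_ifs <;> simp
    have hdeg : p.degree < s.card := by
      have : p.natDegree ≤ Fintype.card (Fin d) := Polynomial.natDegree_det_X_add_C_le M 1
      refine (Polynomial.degree_le_of_natDegree_le this).trans_lt ?_
      simp only [Fintype.card_fin, s, Finset.card_range]
      exact_mod_cast Nat.lt_succ_self d
    have h := congrArg (Polynomial.eval 1) (Lagrange.eq_interpolate ht.injOn hdeg)
    rw [hp, Lagrange.interpolate_apply, Polynomial.eval_finsetSum] at h
    simpa [hp, c, mul_comm] using h
  refine ⟨s, c, ?_, key⟩
  have := key 1
  simpa [ContinuousLinearMap.det] using this.symm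

theorem det_one_add_pos {E : Type*} [NormedAddCommGroup E] [NormedSpace ℝ E]
    [FiniteDimensional ℝ E] {A : E →L[ℝ] E} (hA : ‖A‖ < 1) : 0 < (1 + A).det := by
  have hne : ∀ s ∈ Set.Icc (0 : ℝ) 1, (1 + s • A).det ≠ 0 := by
    intro s hs
    have hlt : ‖-(s • A)‖ < 1 := by
      rw [norm_neg, norm_smul, Real.norm_eq_abs, abs_of_nonneg hs.1]
      nlinarith [norm_nonneg A, hs.2]
    have := (Units.oneSub _ hlt).isUnit
    simp only [Units.val_oneSub, sub_neg_eq_add] at this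
    have h2 : IsUnit (((1 + s • A : E →L[ℝ] E)) : E →ₗ[ℝ] E) :=
      this.map (ContinuousLinearMap.toLinearMapRingHom (R₁ := ℝ) (M₁ := E))
    exact (LinearMap.isUnit_iff_isUnit_det _ |>.1 h2).ne_zero
  have hc : ContinuousOn (fun s : ℝ => (1 + s • A).det) (Set.Icc 0 1) :=
    (ContinuousLinearMap.continuous_det.comp (by fun_prop)).continuousOn
  by_contra h
  have h0 : (0 : ℝ) ∈ Set.Icc ((1 + (1 : ℝ) • A).det) ((1 + (0 : ℝ) • A).det) := by
    constructor
    · simpa using h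
    · simp [ContinuousLinearMap.det]
  obtain ⟨s, hs, h⟩ := intermediate_value_Icc' zero_le_one hc h0
  exact hne s hs h

theorem lipschitzWith_indicator_closedBall {E : Type*} [NormedAddCommGroup E] [NormedSpace ℝ E]
    {g : E → E} {K : NNReal} {R : ℝ} (hg : LipschitzOnWith K g (Metric.closedBall 0 R))
    (h0 : ∀ x, ‖x‖ = R → g x = 0) :
    LipschitzWith K ((Metric.closedBall 0 R).indicator g) := by
  have mixed : ∀ x y, ‖x‖ ≤ R → R < ‖y‖ → ‖g x‖ ≤ K * dist x y := by
    intro x y hx hy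
    have hc : ContinuousOn (fun s : ℝ => ‖x + s • (y - x)‖) (Set.Icc 0 1) := by fun_prop
    obtain ⟨s, hs, hsR⟩ := intermediate_value_Icc zero_le_one hc
      (show R ∈ Set.Icc _ _ by simpa using ⟨hx, hy.le⟩)
    have h := hg.dist_le_mul x (by simpa using hx) (x + s • (y - x)) (by simpa using hsR.le)
    rw [h0 _ hsR, dist_zero_right] at h
    refine h.trans (mul_le_mul_of_nonneg_left ?_ K.2)
    rw [dist_self_add_right, norm_smul, Real.norm_eq_abs, abs_of_nonneg hs.1, dist_comm,
      dist_eq_norm]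
    exact mul_le_of_le_one_left (norm_nonneg _) hs.2
  refine LipschitzWith.of_dist_le_mul fun x y => ?_
  by_cases hx : ‖x‖ ≤ R <;> by_cases hy : ‖y‖ ≤ R
  · simpa [Set.indicator, hx, hy] using hg.dist_le_mul x (by simpa using hx) y (by simpa using hy)
  · simpa [Set.indicator, hx, hy] using mixed x y hx (not_le.1 hy)
  · simpa [Set.indicator, hx, hy, dist_comm x y] using mixed y x hy (not_le.1 hx)
  · simp only [Set.indicator, Metric.mem_closedBall, dist_zero_right, hx, hy, if_false, dist_self]
    positivity

theorem bijective_id_add_of_lipschitzWith {E : Type*} [NormedAddCommGroup E] [NormedSpace ℝ E]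
    [FiniteDimensional ℝ E] {g : E → E} {K : NNReal} (hg : LipschitzWith K g) (hK : K < 1) :
    Function.Bijective fun x => x + g x := by
  have happ : ApproximatesLinearOn (fun x => x + g x)
      ((ContinuousLinearEquiv.refl ℝ E : E ≃L[ℝ] E) : E →L[ℝ] E) Set.univ K := by
    intro x _ y _
    have := hg.dist_le_mul x y
    rw [dist_eq_norm, dist_eq_norm] at this
    rw [show x + g x - (y + g y) - ((ContinuousLinearEquiv.refl ℝ E : E →L[ℝ] E)) (x - y)
      = g x - g y by change x + g x - (y + g y) - (x - y) = _; abel]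
    exact this
  have hc : Subsingleton E ∨
      K < ‖((ContinuousLinearEquiv.refl ℝ E).symm : E →L[ℝ] E)‖₊⁻¹ := by
    rcases subsingleton_or_nontrivial E with h | h
    · exact Or.inl h
    · right
      have h1 : ‖((ContinuousLinearEquiv.refl ℝ E).symm : E →L[ℝ] E)‖₊ = 1 := by
        ext
        exact ContinuousLinearMap.norm_id
      rw [h1, inv_one]
      exact hK
  have := FiniteDimensional.complete ℝ E
  exact ⟨Set.injOn_univ.1 (happ.injOn hc), happ.surjective hc⟩

open MeasureTheory in
/-- The no-retraction theorem for continuously differentiable maps. -/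
theorem not_contDiff_retraction_sphere {E : Type*} [NormedAddCommGroup E] [InnerProductSpace ℝ E]
    [FiniteDimensional ℝ E] {r : E → E} {R : ℝ} (hR : 0 < R) (hr : ContDiff ℝ 1 r)
    (hsphere : ∀ x, ‖r x‖ = R) (hid : ∀ x, ‖x‖ = R → r x = x) : False := by
  borelize E
  set B := Metric.closedBall (0 : E) R
  have hBc : IsCompact B := isCompact_closedBall 0 R
  have hBm : MeasurableSet B := hBc.measurableSet
  have hdiff : Differentiable ℝ r := hr.differentiable one_ne_zero
  have hcont : Continuous (fderiv ℝ r) := hr.continuous_fderiv one_ne_zero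
  obtain ⟨C, hC⟩ := hBc.exists_bound_of_continuousOn
    (f := fun x => fderiv ℝ r x - 1) (by fun_prop)
  set K : NNReal := C.toNNReal + 1
  have hK : ∀ x ∈ B, ‖fderiv ℝ r x - 1‖ ≤ K := fun x hx =>
    (hC x hx).trans ((Real.le_coe_toNNReal C).trans (by simp [K]))
  have hgd : ∀ x, HasFDerivAt (fun x => r x - x) (fderiv ℝ r x - 1) x := fun x =>
    (hdiff x).hasFDerivAt.sub (hasFDerivAt_id x)
  have hlip : LipschitzOnWith K (fun x => r x - x) B :=
    (convex_closedBall 0 R).lipschitzOnWith_of_nnnorm_hasFDerivWithin_le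
      (fun x _ => (hgd x).hasFDerivWithinAt) (fun x hx => hK x hx)
  have hlip' : LipschitzWith K (B.indicator fun x => r x - x) :=
    lipschitzWith_indicator_closedBall hlip fun x hx => by simp [hid x hx]
  have hvol : ∀ t : ℝ, 0 < t → t ≤ 1 → t * K < 1 →
      ∫ x in B, (1 + t • (fderiv ℝ r x - 1)).det = volume.real B := by
    intro t ht0 ht1 htK
    set g := B.indicator fun x => r x - x
    have htlip : LipschitzWith (t.toNNReal * K) (fun x => t • g x) := by
      refine LipschitzWith.of_dist_le_mul fun x y => ?_
      rw [dist_smul₀, Real.norm_eq_abs, abs_of_pos ht0]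
      simpa [mul_assoc, ht0.le] using mul_le_mul_of_nonneg_left (hlip'.dist_le_mul x y) ht0.le
    have hbij := bijective_id_add_of_lipschitzWith htlip
      (by rw [← NNReal.coe_lt_coe]; simpa [ht0.le] using htK)
    have hin : ∀ x ∈ B, x + t • g x ∈ B := by
      intro x hx
      have : x + t • g x = (1 - t) • x + t • r x := by
        simp only [g, Set.indicator_of_mem hx]
        module
      rw [this]
      exact (convex_closedBall 0 R) hx (by simp [hsphere]) (by linarith) ht0.le (by ring)
    have hout : ∀ x ∉ B, x + t • g x = x := fun x hx => by
      simp [g, Set.indicator_of_notMem hx]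
    have himg : (fun x => x + t • (r x - x)) '' B = B := by
      have heq : Set.EqOn (fun x => x + t • (r x - x)) (fun x => x + t • g x) B := fun x hx => by
        simp [g, Set.indicator_of_mem hx]
      rw [heq.image_eq]
      refine Set.Subset.antisymm (Set.image_subset_iff.2 hin) fun y hy => ?_
      obtain ⟨x, hx⟩ := hbij.2 y
      by_cases hxB : x ∈ B
      · exact ⟨x, hxB, hx⟩
      · exact absurd ((hout x hxB ▸ hx : x = y) ▸ hy) hxB
    have hinj : Set.InjOn (fun x => x + t • (r x - x)) B := by
      intro x hx y hy hxy
      apply hbij.1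
      simpa [g, Set.indicator_of_mem hx, Set.indicator_of_mem hy] using hxy
    have hder : ∀ x, HasFDerivAt (fun x => x + t • (r x - x)) (1 + t • (fderiv ℝ r x - 1)) x :=
      fun x => (hasFDerivAt_id x).add ((hgd x).const_smul t)
    have hcv := integral_image_eq_integral_abs_det_fderiv_smul volume hBm
      (fun x _ => (hder x).hasFDerivWithinAt) hinj
      (fun _ => (1 : ℝ))
    rw [himg] at hcv
    simp only [smul_eq_mul, mul_one, integral_const, measureReal_restrict_apply_univ] at hcv
    rw [hcv]
    refine setIntegral_congr_fun hBm fun x hx => ?_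
    refine (abs_of_pos (det_one_add_pos ?_)).symm
    rw [norm_smul, Real.norm_eq_abs, abs_of_pos ht0]
    exact (mul_le_mul_of_nonneg_left (hK x hx) ht0.le).trans_lt htK
  have hK1 : (1 : ℝ) ≤ K := by simp [K]
  set t : ℕ → ℝ := fun i => 1 / ((i + 2) * K)
  have ht : Function.Injective t := by
    intro i j hij
    simp only [t, one_div, inv_inj] at hij
    have := mul_right_cancel₀ (by positivity) hij
    exact_mod_cast (add_right_cancel this)
  obtain ⟨s, c, hc1, hc⟩ := exists_det_eq_sum_det_one_add_smul (E := E) t ht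
  have hdet0 : ∀ x, (fderiv ℝ r x).det = 0 := by
    intro x
    by_contra hne
    have hsurj : Function.Surjective (fderiv ℝ r x) :=
      ((LinearMap.isUnit_iff_isUnit_det _).2 (isUnit_iff_ne_zero.2 hne) |>
        (Module.End.isUnit_iff _).1).2
    obtain ⟨v, hv⟩ := hsurj (r x)
    have hconst : (fun y => inner ℝ (r y) (r y)) = fun _ => R ^ 2 := by
      ext y
      rw [real_inner_self_eq_norm_sq, hsphere]
    have hd := ((hdiff x).hasFDerivAt.inner ℝ (hdiff x).hasFDerivAt)
    rw [hconst] at hd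
    have h := congrArg (fun L : E →L[ℝ] ℝ => L v) (hd.unique (hasFDerivAt_const (R ^ 2) x))
    simp [hv, hsphere] at h
    exact hR.ne' h
  have hfin : (0 : ℝ) = volume.real B := calc
    0 = ∫ x in B, (fderiv ℝ r x).det := by simp [hdet0]
    _ = ∫ x in B, ∑ i ∈ s, c i * (1 + t i • (fderiv ℝ r x - 1)).det := by simp_rw [← hc]
    _ = ∑ i ∈ s, c i * ∫ x in B, (1 + t i • (fderiv ℝ r x - 1)).det := by
      rw [integral_finsetSum]
      · simp_rw [integral_const_mul]
      · intro i _
        refine (Continuous.continuousOn ?_).integrableOn_compact hBc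
        exact continuous_const.mul (ContinuousLinearMap.continuous_det.comp (by fun_prop))
    _ = ∑ i ∈ s, c i * volume.real B := by
      refine Finset.sum_congr rfl fun i _ => ?_
      have h2 : (2 : ℝ) ≤ i + 2 := by simp
      have hpos : 0 < t i := by positivity
      have htK : t i * K < 1 := by
        simp only [t]
        field_simp
        linarith
      rw [hvol (t i) hpos (by nlinarith) htK]
    _ = volume.real B := by rw [← Finset.sum_mul, hc1, one_mul]
  have hpos : 0 < volume.real B := ENNReal.toReal_pos
    (Metric.measure_closedBall_pos volume 0 hR).ne' hBc.measure_lt_top.ne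
  exact hpos.ne hfin

theorem exists_add_eq_zero_of_norm_le {E : Type*} [NormedAddCommGroup E] [InnerProductSpace ℝ E]
    [FiniteDimensional ℝ E] {u : E → E} {M : ℝ} (hu : Continuous u) (hM : ∀ x, ‖u x‖ ≤ M) :
    ∃ x, x + u x = 0 := by
  by_contra! hne
  have hM0 : 0 ≤ M := (norm_nonneg _).trans (hM 0)
  set χ : E → ℝ := fun x => max 0 (min 1 (M + 2 - ‖x‖))
  set w : E → E := fun x => χ x • u x
  have hwne : ∀ x, x + w x ≠ 0 := by
    intro x h
    have hχ0 : 0 ≤ χ x := le_max_left _ _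
    have hχ1 : χ x ≤ 1 := max_le zero_le_one (min_le_left _ _)
    have hx : ‖x‖ ≤ M := by
      rw [eq_neg_of_add_eq_zero_left h, norm_neg, norm_smul, Real.norm_eq_abs, abs_of_nonneg hχ0]
      exact (mul_le_of_le_one_left (norm_nonneg _) hχ1).trans (hM x)
    have hχ : χ x = 1 := by
      simp only [χ]
      rw [min_eq_left (by linarith), max_eq_right zero_le_one]
    simp only [w, hχ, one_smul] at h
    exact hne x h
  have hw : Continuous w := by fun_prop
  obtain ⟨v, hv, hvw, hsupp⟩ := hw.exists_contDiff_approx 1 (ε := fun x => ‖x + w x‖)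
    (by fun_prop) fun x => norm_pos_iff.2 (hwne x)
  have hf : ∀ x, x + v x ≠ 0 := by
    intro x h
    have := hvw x
    rw [eq_neg_of_add_eq_zero_right h, dist_eq_norm, ← norm_neg] at this
    simp at this
    rw [add_comm] at this
    exact lt_irrefl _ this
  have hv0 : ∀ x, ‖x‖ = M + 2 → v x = 0 := by
    intro x hx
    by_contra h
    exact hsupp h (by simp [w, χ, hx])
  have hfd : ContDiff ℝ 1 fun x => x + v x := contDiff_id.add hv
  refine not_contDiff_retraction_sphere (R := M + 2)
    (r := fun x => ((M + 2) * ‖x + v x‖⁻¹) • (x + v x)) (by linarith)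
    ((contDiff_const.mul ((hfd.norm ℝ hf).inv fun x => norm_ne_zero_iff.2 (hf x))).smul hfd) ?_ ?_
  · intro x
    have := norm_ne_zero_iff.2 (hf x)
    rw [norm_smul, norm_mul, norm_inv, norm_norm, inv_mul_cancel_right₀ this, Real.norm_eq_abs,
      abs_of_nonneg (by linarith)]
  · intro x hx
    simp only [hv0 x hx, add_zero, hx]
    rw [mul_inv_cancel₀ (by linarith), one_smul]

theorem exists_mem_closedBall_eq_zero {E : Type*} [NormedAddCommGroup E] [InnerProductSpace ℝ E]
    [FiniteDimensional ℝ E] {ψ : E → E} (hψ : ContinuousOn ψ (Metric.closedBall 0 1))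
    (h : ∀ x ∈ Metric.closedBall (0 : E) 1, ‖ψ x - x‖ ≤ 1) :
    ∃ x ∈ Metric.closedBall (0 : E) 1, ψ x = 0 := by
  set π : E → E := fun x => (max 1 ‖x‖)⁻¹ • x
  have hpos : ∀ x : E, 0 < max 1 ‖x‖ := fun x => lt_max_of_lt_left one_pos
  have hπ : Continuous π :=
    Continuous.smul (Continuous.inv₀ (by fun_prop) fun x => (hpos x).ne') continuous_id
  have hmem : ∀ x, π x ∈ Metric.closedBall (0 : E) 1 := by
    intro x
    rw [mem_closedBall_zero_iff, norm_smul, norm_inv, Real.norm_eq_abs, abs_of_pos (hpos x),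
      inv_mul_le_one₀ (hpos x)]
    exact le_max_right _ _
  obtain ⟨x, hx⟩ := exists_add_eq_zero_of_norm_le (u := fun x => ψ (π x) - π x)
    ((hψ.comp_continuous hπ hmem).sub hπ) fun x => h _ (hmem x)
  have hx1 : ‖x‖ ≤ 1 := by
    rw [eq_neg_of_add_eq_zero_left hx, norm_neg]
    exact h _ (hmem x)
  have hπx : π x = x := by simp [π, hx1]
  refine ⟨x, by simpa using hx1, ?_⟩
  simpa [hπx] using hx

open MeasureTheory in
theorem exists_continuous_approx_ne_zero_on_sphere {E : Type*} [NormedAddCommGroup E]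
    [InnerProductSpace ℝ E] [FiniteDimensional ℝ E] {H : E → E} (hH : Continuous H) (c : E)
    {ε δ : ℝ} (hε : ε ≠ 0) (hδ : 0 < δ) :
    ∃ Q : E → E, Continuous Q ∧ (∀ y, ‖Q y - H y‖ < δ) ∧ ∀ y ∈ Metric.sphere c ε, Q y ≠ 0 := by
  borelize E
  obtain ⟨P, hP, hPH, -⟩ := hH.exists_contDiff_approx 1 (ε := fun _ => δ / 2)
    continuous_const fun _ => half_pos hδ
  have hnull : volume (P '' Metric.sphere c ε) = 0 :=
    addHaar_image_eq_zero_of_differentiableOn_of_addHaar_eq_zero volume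
      (hP.differentiable one_ne_zero).differentiableOn
      (Measure.addHaar_sphere_of_ne_zero volume c hε)
  obtain ⟨p, hp, hpn⟩ : ∃ p ∈ Metric.ball (0 : E) (δ / 2), p ∉ P '' Metric.sphere c ε := by
    by_contra! h
    exact (Metric.measure_ball_pos volume (0 : E) (half_pos hδ)).ne' (measure_mono_null h hnull)
  refine ⟨fun y => P y - p, hP.continuous.sub continuous_const, fun y => ?_, fun y hy h => ?_⟩
  · have h1 := hPH y
    rw [dist_eq_norm] at h1
    have h2 := mem_ball_zero_iff.1 hp
    calc ‖P y - p - H y‖ = ‖(P y - H y) - p‖ := by congr 1; abel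
      _ ≤ ‖P y - H y‖ + ‖p‖ := norm_sub_le _ _
      _ < δ := by linarith
  · exact hpn ⟨y, hy, sub_eq_zero.1 h⟩

theorem image_closedBall_mem_nhds {E : Type*} [NormedAddCommGroup E] [InnerProductSpace ℝ E]
    [FiniteDimensional ℝ E] {f : E → E} (hf : ContinuousOn f (Metric.closedBall 0 1))
    (hinj : Set.InjOn f (Metric.closedBall 0 1)) :
    f '' Metric.closedBall 0 1 ∈ nhds (f 0) := by
  set B := Metric.closedBall (0 : E) 1
  have hBc : IsCompact B := isCompact_closedBall 0 1
  have h0B : (0 : E) ∈ B := Metric.mem_closedBall_self zero_le_one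
  have : CompactSpace B := isCompact_iff_compactSpace.1 hBc
  have : TietzeExtension E := TietzeExtension.of_tvs ℝ
  have he : Topology.IsClosedEmbedding fun x : B => f x :=
    hf.domRestrict.isClosedEmbedding hinj.injective
  obtain ⟨H, hH⟩ := ContinuousMap.exists_extension' he ⟨((↑) : B → E), continuous_subtype_val⟩
  have hHf : ∀ x ∈ B, H (f x) = x := fun x hx => congrFun hH ⟨x, hx⟩
  by_contra hnot
  obtain ⟨η, hη, hHη⟩ := Metric.continuousAt_iff.1 (H.continuous.continuousAt (x := f 0)) (1 / 10)
    (by norm_num)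
  simp only [hHf 0 h0B, dist_zero_right] at hHη
  obtain ⟨ε, hε, rfl⟩ : ∃ ε, 0 < ε ∧ η = 2 * ε := ⟨η / 2, half_pos hη, by ring⟩
  obtain ⟨c, hcB, hc⟩ : ∃ c ∉ f '' B, dist (f 0) c < ε := by
    rw [← mem_interior_iff_mem_nhds, ← Set.notMem_compl_iff, not_not, ← closure_compl] at hnot
    exact Metric.mem_closure_iff.1 hnot ε hε
  have hsmall : ∀ y, ‖y - c‖ ≤ ε → ‖H y‖ < 1 / 10 := by
    intro y hy
    refine hHη ?_
    rw [dist_comm] at hc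
    rw [← dist_eq_norm] at hy
    linarith [dist_triangle y c (f 0)]
  obtain ⟨δ, hδ, hHδ⟩ := (hBc.image_of_continuousOn hf |>.inter_right
    (isClosed_le continuous_const (by fun_prop : Continuous fun y => ‖y - c‖)) :
      IsCompact (f '' B ∩ {y | ε ≤ ‖y - c‖})).exists_forall_le' (f := fun y => ‖H y‖) (a := 0)
    (by fun_prop) (by
      rintro _ ⟨⟨x, hx, rfl⟩, hxε⟩
      rw [norm_pos_iff, hHf x hx]
      rintro rfl
      rw [dist_eq_norm] at hc
      exact absurd hxε (not_le.2 hc))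
  obtain ⟨Q, hQ, hQH, hQs⟩ := exists_continuous_approx_ne_zero_on_sphere H.continuous c hε.ne'
    (lt_min hδ (by norm_num : (0 : ℝ) < 1 / 10))
  set Φ : E → E := fun y => c + max (ε / ‖y - c‖) 1 • (y - c)
  have hne : ∀ x ∈ B, f x - c ≠ 0 := fun x hx h => hcB ⟨x, hx, sub_eq_zero.1 h⟩
  have hΦf : ContinuousOn (fun x => Φ (f x)) B := by
    have h1 : ContinuousOn (fun x => f x - c) B := hf.sub continuousOn_const
    have h2 : ContinuousOn (fun x => ε / ‖f x - c‖) B :=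
      continuousOn_const.div h1.norm fun x hx => norm_ne_zero_iff.2 (hne x hx)
    exact continuousOn_const.add ((ContinuousOn.sup h2 continuousOn_const).smul h1)
  have hfar : ∀ x ∈ B, ε ≤ ‖f x - c‖ → Φ (f x) = f x := by
    intro x hx h
    have : ε / ‖f x - c‖ ≤ 1 := div_le_one_of_le₀ h (norm_nonneg _)
    simp [Φ, max_eq_right this]
  have hnear : ∀ x ∈ B, ‖f x - c‖ ≤ ε → ‖Φ (f x) - c‖ = ε := by
    intro x hx h
    have hpos := norm_pos_iff.2 (hne x hx)
    have : 1 ≤ ε / ‖f x - c‖ := (one_le_div hpos).2 h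
    simp only [Φ, max_eq_left this, add_sub_cancel_left]
    rw [norm_smul, Real.norm_eq_abs, abs_of_pos (by positivity), div_mul_cancel₀ _ hpos.ne']
  obtain ⟨x, hx, hx0⟩ := exists_mem_closedBall_eq_zero (hQ.comp_continuousOn hΦf) (by
    intro x hx
    rcases le_total ε ‖f x - c‖ with h | h
    · have := hQH (f x)
      rw [hHf x hx] at this
      simp only [Function.comp, hfar x hx h]
      linarith [min_le_right δ (1 / 10 : ℝ)]
    · have h1 := hQH (Φ (f x))
      have h2 := hsmall _ (hnear x hx h).le
      have h3 := hsmall _ h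
      rw [hHf x hx] at h3
      have h4 := norm_sub_le (Q (Φ (f x)) - H (Φ (f x)) + H (Φ (f x))) x
      have h5 := norm_add_le (Q (Φ (f x)) - H (Φ (f x))) (H (Φ (f x)))
      rw [sub_add_cancel] at h4 h5
      simp only [Function.comp]
      linarith [min_le_right δ (1 / 10 : ℝ)])
  simp only [Function.comp] at hx0
  rcases le_total ε ‖f x - c‖ with h | h
  · rw [hfar x hx h] at hx0
    have h1 := hQH (f x)
    rw [hx0, zero_sub, norm_neg] at h1
    linarith [hHδ (f x) ⟨⟨x, hx, rfl⟩, h⟩, min_le_left δ (1 / 10 : ℝ)]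
  · exact hQs _ (mem_sphere_iff_norm.2 (hnear x hx h)) hx0

/-- **Invariance of domain.** -/
theorem isOpen_image_of_continuousOn_of_injOn {E : Type*} [NormedAddCommGroup E]
    [InnerProductSpace ℝ E] [FiniteDimensional ℝ E] {f : E → E} {Ω : Set E} (hΩ : IsOpen Ω)
    (hf : ContinuousOn f Ω) (hinj : Set.InjOn f Ω) : IsOpen (f '' Ω) := by
  rw [isOpen_iff_mem_nhds]
  rintro _ ⟨a, ha, rfl⟩
  obtain ⟨ρ, hρ, hball⟩ := Metric.nhds_basis_closedBall.mem_iff.1 (hΩ.mem_nhds ha)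
  set s : E → E := fun x => a + ρ • x
  have hs : Set.MapsTo s (Metric.closedBall 0 1) Ω := by
    intro x hx
    apply hball
    rw [mem_closedBall_zero_iff] at hx
    rw [mem_closedBall_iff_norm, add_sub_cancel_left, norm_smul, Real.norm_eq_abs, abs_of_pos hρ]
    exact mul_le_of_le_one_right hρ.le hx
  have hsinj : Function.Injective s := fun x y h =>
    smul_right_injective E hρ.ne' (add_left_cancel h)
  have h := image_closedBall_mem_nhds (f := f ∘ s) (hf.comp (by fun_prop) hs)
    (hinj.comp hsinj.injOn hs)
  simp only [Function.comp, s, smul_zero, add_zero] at h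
  refine Filter.mem_of_superset h ?_
  rintro _ ⟨x, hx, rfl⟩
  exact ⟨s x, hs hx, rfl⟩

theorem image_subset_image_of_eqOn_near_frontier {E : Type*} [NormedAddCommGroup E]
    [InnerProductSpace ℝ E] [FiniteDimensional ℝ E] {Ω U : Set E} {F G : E → E}
    (hΩ : IsOpen Ω) (hΩc : IsConnected Ω) (hΩb : Bornology.IsBounded Ω)
    (hF : ContinuousOn F Ω) (hFi : Set.InjOn F Ω) (hG : ContinuousOn G Ω) (hGi : Set.InjOn G Ω)
    (hU : IsOpen U) (hfU : frontier Ω ⊆ U) (hFG : Set.EqOn F G (U ∩ Ω)) :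
    G '' Ω ⊆ F '' Ω := by
  rcases subsingleton_or_nontrivial E with hE | hE
  · rw [Subsingleton.elim F G]
  have hmeet : (U ∩ Ω).Nonempty := by
    have hne : Ω ≠ Set.univ := by
      rintro rfl
      exact NormedSpace.unbounded_univ ℝ E hΩb
    obtain ⟨p, hp⟩ := nonempty_frontier_iff.2 ⟨hΩc.nonempty, hne⟩
    exact mem_closure_iff.1 (frontier_subset_closure hp) U hU (hfU hp)
  refine (hΩc.isPreconnected.image G hG).subset_of_closure_inter_subset
    (isOpen_image_of_continuousOn_of_injOn hΩ hF hFi) ?_ ?_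
  · obtain ⟨z, hz⟩ := hmeet
    exact ⟨G z, ⟨z, hz.2, rfl⟩, ⟨z, hz.2, hFG hz⟩⟩
  rintro _ ⟨hy, x, hx, rfl⟩
  have hKΩ : closure Ω \ U ⊆ Ω := by
    intro z hz
    by_contra h
    exact hz.2 (hfU ⟨hz.1, by rwa [hΩ.interior_eq]⟩)
  have hK : IsClosed (F '' (closure Ω \ U)) :=
    ((hΩb.isCompact_closure.diff hU).image_of_continuousOn (hF.mono hKΩ)).isClosed
  have hcover : F '' Ω ⊆ F '' (closure Ω \ U) ∪ G '' (U ∩ Ω) := by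
    rintro _ ⟨z, hz, rfl⟩
    by_cases hzU : z ∈ U
    · exact Or.inr ⟨z, ⟨hzU, hz⟩, (hFG ⟨hzU, hz⟩).symm⟩
    · exact Or.inl ⟨z, ⟨subset_closure hz, hzU⟩, rfl⟩
  have hy' := closure_mono hcover hy
  rw [closure_union, hK.closure_eq] at hy'
  rcases hy' with h | h
  · exact Set.image_mono hKΩ h
  have hxcl : x ∈ closure (U ∩ Ω) := by
    by_contra hxn
    have hW : IsOpen (G '' (Ω \ closure (U ∩ Ω))) :=
      isOpen_image_of_continuousOn_of_injOn (hΩ.sdiff isClosed_closure)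
        (hG.mono Set.sdiff_subset) (hGi.mono Set.sdiff_subset)
    obtain ⟨_, ⟨z, hz, rfl⟩, ⟨z', hz', hzz⟩⟩ := mem_closure_iff.1 h _ hW ⟨x, ⟨hx, hxn⟩, rfl⟩
    exact hz.2 (subset_closure (hGi hz'.2 hz.1 hzz ▸ hz'))
  have := mem_closure_iff_nhdsWithin_neBot.1 hxcl
  have hFx := (hF.continuousAt (hΩ.mem_nhds hx)).mono_left
    (nhdsWithin_le_nhds (s := U ∩ Ω))
  have hGx := (hG.continuousAt (hΩ.mem_nhds hx)).mono_left
    (nhdsWithin_le_nhds (s := U ∩ Ω))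
  exact ⟨x, hx, tendsto_nhds_unique (hFx.congr' hFG.eventuallyEq_nhdsWithin) hGx⟩

/-- Gluing homeomorphisms: if `F` on `Ω₁` and `G` on `Ω₂ ⊆ Ω₁` agree on a neighborhood of
`∂Ω₂` intersected with `Ω₂`, then the glued map (equal to `G` on `Ω₂`, `F` outside) is a
homeomorphism of `Ω₁` onto `F(Ω₁)`. -/
theorem stmt5 {n : ℕ} (Ω₁ Ω₂ : Set (EuclideanSpace ℝ (Fin n)))
    (hsub : Ω₂ ⊆ Ω₁)
    (hΩ₁o : IsOpen Ω₁) (hΩ₁c : IsConnected Ω₁) (hΩ₁b : Bornology.IsBounded Ω₁)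
    (hΩ₂o : IsOpen Ω₂) (hΩ₂c : IsConnected Ω₂)
    (F G : EuclideanSpace ℝ (Fin n) → EuclideanSpace ℝ (Fin n))
    (hF : Topology.IsEmbedding (Ω₁.restrict F))
    (hG : Topology.IsEmbedding (Ω₂.restrict G))
    (hFG : ∃ U : Set (EuclideanSpace ℝ (Fin n)), IsOpen U ∧ frontier Ω₂ ⊆ U ∧
      ∀ x ∈ U ∩ Ω₂, F x = G x)
    (Ft : EuclideanSpace ℝ (Fin n) → EuclideanSpace ℝ (Fin n))
    (hFt : ∀ x, Ft x = if x ∈ Ω₂ then G x else F x) :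
    Topology.IsEmbedding (Ω₁.restrict Ft) ∧ Ft '' Ω₁ = F '' Ω₁ := by
  obtain ⟨U, hU, hfU, hFG⟩ := hFG
  have hFc : ContinuousOn F Ω₁ := continuousOn_iff_continuous_domRestrict.2 hF.continuous
  have hFi : Set.InjOn F Ω₁ := Set.injOn_iff_injective.2 hF.injective
  have hGc : ContinuousOn G Ω₂ := continuousOn_iff_continuous_domRestrict.2 hG.continuous
  have hGi : Set.InjOn G Ω₂ := Set.injOn_iff_injective.2 hG.injective
  have hΩ₂b := hΩ₁b.subset hsub
  have himg : G '' Ω₂ = F '' Ω₂ := Set.Subset.antisymm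
    (image_subset_image_of_eqOn_near_frontier hΩ₂o hΩ₂c hΩ₂b (hFc.mono hsub) (hFi.mono hsub)
      hGc hGi hU hfU hFG)
    (image_subset_image_of_eqOn_near_frontier hΩ₂o hΩ₂c hΩ₂b hGc hGi (hFc.mono hsub)
      (hFi.mono hsub) hU hfU fun x hx => (hFG x hx).symm)
  have hin : Set.EqOn Ft G Ω₂ := fun x hx => by rw [hFt, if_pos hx]
  have hout : Set.EqOn Ft F (U ∪ (closure Ω₂)ᶜ) := by
    intro x hx
    rw [hFt]
    split_ifs with h
    · exact (hFG x ⟨hx.resolve_right (not_not.2 (subset_closure h)), h⟩).symm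
    · rfl
  have hcover : ∀ x ∉ Ω₂, x ∈ U ∪ (closure Ω₂)ᶜ := by
    intro x hx
    by_cases h : x ∈ closure Ω₂
    · exact Or.inl (hfU ⟨h, by rwa [hΩ₂o.interior_eq]⟩)
    · exact Or.inr h
  have hc : ContinuousOn Ft Ω₁ := by
    intro x hx
    apply ContinuousAt.continuousWithinAt
    by_cases h : x ∈ Ω₂
    · exact (hGc.continuousAt (hΩ₂o.mem_nhds h)).congr
        (hin.eventuallyEq_of_mem (hΩ₂o.mem_nhds h)).symm
    · exact (hFc.continuousAt (hΩ₁o.mem_nhds hx)).congr (hout.eventuallyEq_of_mem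
        ((hU.union isClosed_closure.isOpen_compl).mem_nhds (hcover x h))).symm
  have hsep : ∀ x ∈ Ω₂, ∀ y ∈ Ω₁, y ∉ Ω₂ → Ft x ≠ Ft y := by
    intro x hx y hy hy' h
    rw [hin hx, hout (hcover y hy')] at h
    obtain ⟨z, hz, hzx⟩ : G x ∈ F '' Ω₂ := himg ▸ ⟨x, hx, rfl⟩
    exact hy' (hFi (hsub hz) hy (hzx.trans h) ▸ hz)
  have hi : Set.InjOn Ft Ω₁ := by
    intro x hx y hy h
    by_cases hx' : x ∈ Ω₂ <;> by_cases hy' : y ∈ Ω₂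
    · exact hGi hx' hy' (by rwa [hin hx', hin hy'] at h)
    · exact absurd h (hsep x hx' y hy hy')
    · exact absurd h.symm (hsep y hy' x hx hx')
    · exact hFi hx hy (by rwa [hout (hcover x hx'), hout (hcover y hy')] at h)
  refine ⟨(Topology.IsOpenEmbedding.of_continuous_injective_isOpenMap
    (continuousOn_iff_continuous_domRestrict.1 hc) (Set.injOn_iff_injective.1 hi) ?_).isEmbedding,
    ?_⟩
  · intro V hV
    have hV' := hΩ₁o.isOpenMap_subtype_val V hV
    have hsub' : ((↑) '' V : Set (EuclideanSpace ℝ (Fin n))) ⊆ Ω₁ := Subtype.coe_image_subset _ _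
    have h := isOpen_image_of_continuousOn_of_injOn hV' (hc.mono hsub') (hi.mono hsub')
    rwa [Set.image_image] at h
  · rw [← Set.union_sdiff_cancel hsub, Set.image_union, Set.image_union, hin.image_eq, himg,
      Set.EqOn.image_eq fun x hx => hout (hcover x hx.2)]
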